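/- arXiv:2601.10391 — 4 statements merged into one kernel-verified Lean document; each statement's English description precedes it below -/
import Mathlib

section
/- Let D > 0 and let N ≥ 1 be an integer. For the equally spaced samples t_i = i·D/(N+1), i = 1, ..., N, one has (1/D) ∫_0^D min_{1≤i≤N} |θ − t_i| dθ = (N + 3)·D / (4(N + 1)²). In particular, for θ uniformly distributed on [0, D], the expected distance to the nearest sample equals (N + 3)D/(4(N+1)²). -/
open intervalIntegral

theorem integral_abs_sub_from_center (c b : ℝ) :
    ∫ x in c..b, |x - c| = (b - c) * |b - c| / 2 := by
  rcases le_total c b with h | h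
  · rw [integral_congr (g := fun x => x - c), abs_of_nonneg (sub_nonneg.2 h)]
    · simp
      ring
    · intro x hx
      rw [Set.uIcc_of_le h] at hx
      exact abs_of_nonneg (sub_nonneg.2 hx.1)
  · rw [integral_congr (g := fun x => c - x), abs_of_nonpos (sub_nonpos.2 h)]
    · rw [integral_sub (by simp) (by simp)]
      simp
      ring
    · intro x hx
      rw [Set.uIcc_of_ge h] at hx
      exact (abs_of_nonpos (sub_nonpos.2 hx.2)).trans (neg_sub x c)

theorem intervalIntegrable_abs_sub (a b c : ℝ) :
    IntervalIntegrable (fun x => |x - c|) MeasureTheory.volume a b :=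
  (by fun_prop : Continuous fun x : ℝ => |x - c|).intervalIntegrable a b

theorem integral_abs_sub_eq (a b c : ℝ) :
    ∫ x in a..b, |x - c| = ((b - c) * |b - c| - (a - c) * |a - c|) / 2 := by
  rw [← integral_interval_sub_left (intervalIntegrable_abs_sub c b c)
    (intervalIntegrable_abs_sub c a c), integral_abs_sub_from_center,
    integral_abs_sub_from_center]
  ring

theorem intervalIntegrable_and_integral_of_eq_abs_sub {f : ℝ → ℝ} {a b c : ℝ} (hab : a ≤ b)
    (hf : ∀ x ∈ Set.Icc a b, f x = |x - c|) :
    IntervalIntegrable f MeasureTheory.volume a b ∧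
      ∫ x in a..b, f x = ((b - c) * |b - c| - (a - c) * |a - c|) / 2 := by
  rw [← Set.uIcc_of_le hab] at hf
  refine ⟨(intervalIntegrable_abs_sub a b c).congr fun x hx =>
    (hf x (Set.uIoc_subset_uIcc hx)).symm, ?_⟩
  rw [integral_congr hf, integral_abs_sub_eq]

theorem iInf_eq_of_forall_ge {ι : Type*} [Finite ι] {g : ι → ℝ} (i : ι) (h : ∀ j, g i ≤ g j) :
    ⨅ j, g j = g i :=
  haveI : Nonempty ι := ⟨i⟩
  le_antisymm (ciInf_le (Set.finite_range g).bddBelow i) (le_ciInf h)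

/-- A point within `h / 2` of a multiple `m * h` is at least as close to it as to any other. -/
theorem abs_sub_mul_le_of_abs_sub_le_half {h x : ℝ} (hh : 0 ≤ h) (m n : ℕ)
    (hx : |x - m * h| ≤ h / 2) : |x - m * h| ≤ |x - n * h| := by
  rcases lt_trichotomy m n with hmn | rfl | hmn
  · have h1 : (m : ℝ) + 1 ≤ n := by exact_mod_cast hmn
    have h2 := mul_le_mul_of_nonneg_right h1 hh
    have h3 := neg_le_abs (x - n * h)
    have h4 := (abs_le.1 hx).2
    linarith
  · exact le_rfl
  · have h1 : (n : ℝ) + 1 ≤ m := by exact_mod_cast hmn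
    have h2 := mul_le_mul_of_nonneg_right h1 hh
    have h3 := le_abs_self (x - n * h)
    have h4 := (abs_le.1 hx).1
    linarith

theorem integral_iInf_abs_sub_multiples {h : ℝ} (hh : 0 ≤ h) (n : ℕ) :
    ∫ x in (0 : ℝ)..(n + 2) * h, ⨅ i : Fin (n + 1), |x - ((i.val + 1 : ℕ) : ℝ) * h| =
      (n + 4) * h ^ 2 / 4 := by
  set f : ℝ → ℝ := fun x => ⨅ i : Fin (n + 1), |x - ((i.val + 1 : ℕ) : ℝ) * h| with hf
  have left := intervalIntegrable_and_integral_of_eq_abs_sub (f := f) (a := 0) (b := h / 2)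
    (c := h) (by linarith) (by
      rintro x ⟨-, hx⟩
      have key := iInf_eq_of_forall_ge
        (g := fun i : Fin (n + 1) => |x - ((i.val + 1 : ℕ) : ℝ) * h|) 0 (by
          intro j
          have h0 := mul_nonneg (Nat.cast_nonneg (α := ℝ) j.val) hh
          have h1 := neg_le_abs (x - ((j.val + 1 : ℕ) : ℝ) * h)
          push_cast at h1 ⊢
          simp only [Fin.val_zero, Nat.cast_zero]
          rw [abs_of_nonpos (by linarith)]
          linarith)
      simpa [hf] using key)
  have right := intervalIntegrable_and_integral_of_eq_abs_sub (f := f)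
    (a := (n + 1 : ℕ) * h + h / 2) (b := (n + 2) * h) (c := (n + 1) * h)
    (by push_cast; linarith) (by
      rintro x ⟨hx, -⟩
      have key := iInf_eq_of_forall_ge
        (g := fun i : Fin (n + 1) => |x - ((i.val + 1 : ℕ) : ℝ) * h|) (Fin.last n) (by
          intro j
          have h0 := mul_le_mul_of_nonneg_right
            (Nat.cast_le (α := ℝ).2 (Nat.lt_succ_iff.1 j.isLt)) hh
          have h1 := le_abs_self (x - ((j.val + 1 : ℕ) : ℝ) * h)
          push_cast at h1 hx ⊢
          rw [abs_of_nonneg (by linarith)]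
          linarith)
      simpa [hf] using key)
  have cell (k : ℕ) (hk : k < n + 1) := intervalIntegrable_and_integral_of_eq_abs_sub (f := f)
    (a := k * h + h / 2) (b := (k + 1 : ℕ) * h + h / 2) (c := (k + 1 : ℕ) * h)
    (by push_cast; linarith) (by
      rintro x ⟨hx, hx'⟩
      refine iInf_eq_of_forall_ge
        (g := fun i : Fin (n + 1) => |x - ((i.val + 1 : ℕ) : ℝ) * h|) ⟨k, hk⟩ fun j =>
          abs_sub_mul_le_of_abs_sub_le_half hh _ _ (abs_le.2 ⟨?_, ?_⟩)
      · push_cast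
        linarith
      · linarith)
  have middle_integrable := IntervalIntegrable.trans_iterate
    (a := fun k : ℕ => (k : ℝ) * h + h / 2) fun k hk => (cell k hk).1
  have middle := sum_integral_adjacent_intervals
    (a := fun k : ℕ => (k : ℝ) * h + h / 2) fun k hk => (cell k hk).1
  have cell_value : ∀ k ∈ Finset.range (n + 1),
      ∫ x in (k : ℝ) * h + h / 2..((k + 1 : ℕ) : ℝ) * h + h / 2, f x = h ^ 2 / 4 := by
    intro k hk
    rw [(cell k (Finset.mem_range.1 hk)).2, abs_of_nonneg (by linarith),
      abs_of_nonpos (by push_cast; linarith)]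
    push_cast
    ring
  rw [Finset.sum_congr rfl cell_value] at middle
  simp only [Nat.cast_zero, zero_mul, zero_add, Finset.sum_const, Finset.card_range,
    nsmul_eq_mul] at middle middle_integrable
  rw [← integral_add_adjacent_intervals (left.1.trans middle_integrable) right.1,
    ← integral_add_adjacent_intervals left.1 middle_integrable, left.2, right.2, ← middle,
    abs_of_nonpos (by linarith : h / 2 - h ≤ 0), abs_of_nonpos (by linarith : 0 - h ≤ 0),
    abs_of_nonneg (by linarith : 0 ≤ (n + 2) * h - (n + 1) * h),
    abs_of_nonneg (by push_cast; linarith)]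
  push_cast
  ring

/-- For the equally spaced samples `t i = i·D/(N+1)`, `i = 1, ..., N`, the expected
distance of a uniform point of `[0, D]` to the nearest sample equals
`(N+3)·D/(4(N+1)²)`. -/
theorem expected_min_dist_equally_spaced (D : ℝ) (hD : 0 < D) (N : ℕ) (hN : 1 ≤ N) :
    (1 / D) * (∫ θ in (0 : ℝ)..D,
        ⨅ i : Fin N, |θ - ((i.val + 1 : ℝ) * D / ((N : ℝ) + 1))|) =
      ((N : ℝ) + 3) * D / (4 * ((N : ℝ) + 1) ^ 2) := by
  obtain ⟨n, rfl⟩ := Nat.exists_eq_add_of_le' hN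
  have hn : (n : ℝ) + 2 ≠ 0 := by positivity
  have key := integral_iInf_abs_sub_multiples (h := D / (n + 2)) (by positivity) n
  rw [mul_div_cancel₀ D hn] at key
  have hn' : ((n + 1 : ℕ) : ℝ) + 1 = n + 2 := by
    push_cast
    ring
  simp only [hn', mul_div_assoc]
  push_cast at key ⊢
  rw [key]
  field_simp
  ring
end

section
/- Let D > 0 and let N ≥ 1 be an integer. For every choice of real numbers s_1, ..., s_N (not necessarily inside [0, D]), ∫_0^D min_{1≤i≤N} |θ − s_i| dθ ≥ D²/(4N). Equivalently, for θ uniformly distributed on [0, D], the expected distance to the nearest of any N sample points is at least D/(4N). -/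
open intervalIntegral

/-- The integral of the tent function of height and half-width `c` centred at `a` over any interval
is at most `c²`. -/
theorem intervalIntegral_tent_le_sq {c : ℝ} (hc : 0 ≤ c) (a : ℝ) {p q : ℝ} (hpq : p ≤ q) :
    (∫ x in p..q, max 0 (c - |x - a|)) ≤ c ^ 2 := by
  have hcont : Continuous fun x : ℝ => max 0 (c - |x - a|) := by fun_prop
  have hint : MeasureTheory.Integrable fun x : ℝ => max 0 (c - |x - a|) := by
    refine hcont.integrable_of_hasCompactSupport
      (HasCompactSupport.intro (isCompact_Icc (a := a - c) (b := a + c)) fun x hx => ?_)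
    refine max_eq_left ?_
    by_contra! h
    obtain ⟨h₁, h₂⟩ := abs_lt.mp (sub_pos.mp h)
    exact hx ⟨by linarith, by linarith⟩
  calc (∫ x in p..q, max 0 (c - |x - a|))
      = ∫ x in Set.Ioc p q, max 0 (c - |x - a|) := integral_of_le hpq
    _ ≤ ∫ x, max 0 (c - |x - a|) :=
      MeasureTheory.setIntegral_le_integral hint (.of_forall fun x => le_max_left _ _)
    _ = ∫ x, max 0 (c - |x|) :=
      MeasureTheory.integral_sub_right_eq_self (fun x => max 0 (c - |x|)) a
    _ = 2 * ∫ x in Set.Ioi 0, max 0 (c - x) := integral_comp_abs (f := fun x => max 0 (c - x))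
    _ = 2 * ∫ x in (0 : ℝ)..c, max 0 (c - x) := by
      rw [integral_of_le hc]
      congr 1
      refine MeasureTheory.setIntegral_eq_of_subset_of_forall_sdiff_eq_zero measurableSet_Ioi
        Set.Ioc_subset_Ioi_self fun x hx => max_eq_left ?_
      by_contra! h
      exact hx.2 ⟨hx.1, by linarith⟩
    _ = 2 * ∫ x in (0 : ℝ)..c, (c - x) := by
      congr 1
      refine integral_congr fun x hx => max_eq_right ?_
      rw [Set.uIcc_of_le hc] at hx
      linarith [hx.2]
    _ = c ^ 2 := by
      rw [integral_sub (by simp) (by simp)]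
      simp
      ring

theorem continuous_iInf_abs_sub {ι : Type*} [Fintype ι] [Nonempty ι] (s : ι → ℝ) :
    Continuous fun x : ℝ => ⨅ i, |x - s i| := by
  simp_rw [← Finset.inf'_univ_eq_ciInf]
  exact Continuous.finset_inf'_apply _ fun i _ => by fun_prop

theorem sub_sum_tent_le_iInf_abs_sub {ι : Type*} [Fintype ι] [Nonempty ι] (s : ι → ℝ) (c x : ℝ) :
    c - ∑ i, max 0 (c - |x - s i|) ≤ ⨅ i, |x - s i| := by
  refine le_ciInf fun j => ?_
  have h : max 0 (c - |x - s j|) ≤ ∑ i, max 0 (c - |x - s i|) :=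
    Finset.single_le_sum (f := fun i => max 0 (c - |x - s i|))
      (fun i _ => le_max_left _ _) (Finset.mem_univ j)
  linarith [le_max_right 0 (c - |x - s j|)]

/-- For any `N` sample points `s 0, ..., s (N-1)` in `ℝ`, the integral over `[0, D]`
of the distance to the nearest sample is at least `D²/(4N)`; equivalently, the
expected distance for a uniform point of `[0, D]` is at least `D/(4N)`. -/
theorem min_dist_lower_bound (D : ℝ) (hD : 0 < D) (N : ℕ) (hN : 1 ≤ N)
    (s : Fin N → ℝ) :
    D ^ 2 / (4 * (N : ℝ)) ≤ (∫ θ in (0 : ℝ)..D, ⨅ i : Fin N, |θ - s i|) ∧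
    D / (4 * (N : ℝ)) ≤ (1 / D) * (∫ θ in (0 : ℝ)..D, ⨅ i : Fin N, |θ - s i|) := by
  have : Nonempty (Fin N) := ⟨⟨0, hN⟩⟩
  have hN' : (0 : ℝ) < N := by exact_mod_cast hN
  have key : D ^ 2 / (4 * (N : ℝ)) ≤ ∫ θ in (0 : ℝ)..D, ⨅ i : Fin N, |θ - s i| := by
    set c : ℝ := D / (2 * N) with hc
    have hc0 : 0 ≤ c := by positivity
    have htent (i : Fin N) : Continuous fun θ : ℝ => max 0 (c - |θ - s i|) := by fun_prop
    have hsum : Continuous fun θ : ℝ => ∑ i, max 0 (c - |θ - s i|) :=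
      continuous_finsetSum _ fun i _ => htent i
    calc D ^ 2 / (4 * (N : ℝ)) = D * c - ∑ _i : Fin N, c ^ 2 := by
          simp only [Finset.sum_const, Finset.card_univ, Fintype.card_fin, nsmul_eq_mul, hc]
          field_simp
          ring
      _ ≤ D * c - ∑ i, ∫ θ in (0 : ℝ)..D, max 0 (c - |θ - s i|) := by
          gcongr with i
          exact intervalIntegral_tent_le_sq hc0 (s i) hD.le
      _ = ∫ θ in (0 : ℝ)..D, (c - ∑ i, max 0 (c - |θ - s i|)) := by
          rw [integral_sub (by simp) (hsum.intervalIntegrable _ _),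
            integral_finsetSum fun i _ => (htent i).intervalIntegrable _ _]
          simp
      _ ≤ ∫ θ in (0 : ℝ)..D, ⨅ i : Fin N, |θ - s i| :=
          integral_mono_on hD.le ((continuous_const.sub hsum).intervalIntegrable _ _)
            ((continuous_iInf_abs_sub s).intervalIntegrable _ _)
            fun θ _ => sub_sum_tent_le_iInf_abs_sub s c θ
  refine ⟨key, ?_⟩
  calc D / (4 * (N : ℝ)) = 1 / D * (D ^ 2 / (4 * N)) := by field_simp
    _ ≤ _ := by gcongr
end

section
/- Let 0 < a < b be real numbers. The function c ↦ ∫_a^b |1/r − 1/c| dr, defined for c ∈ [a, b], attains its minimum uniquely at c* = (a + b)/2, and the minimum value equals log((a + b)²/(4·a·b)). Consequently, for r uniformly distributed on [a, b], the minimum over c ∈ [a, b] of E[|1/r − 1/c|] equals (1/(b − a))·log((a + b)²/(4ab)). -/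
open intervalIntegral Real

/-- The inverse-range distortion of a representative `c ∈ [a, b]` in closed form. -/
theorem integral_abs_one_div_sub_one_div {a b c : ℝ} (ha : 0 < a) (hc : c ∈ Set.Icc a b) :
    (∫ r in a..b, |1 / r - 1 / c|) =
      2 * Real.log c - Real.log a - Real.log b + (a + b) / c - 2 := by
  obtain ⟨hac, hcb⟩ := hc
  have hc0 : 0 < c := ha.trans_le hac
  have hb0 : 0 < b := hc0.trans_le hcb
  have hint : ∀ x y : ℝ, 0 < x → 0 < y →
      IntervalIntegrable (fun r : ℝ => 1 / r) MeasureTheory.volume x y := fun x y hx hy =>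
    intervalIntegrable_one_div (fun r hr => ((lt_min hx hy).trans_le hr.1).ne') continuousOn_id
  have hdist : ∀ x y : ℝ, 0 < x → 0 < y →
      IntervalIntegrable (fun r : ℝ => |1 / r - 1 / c|) MeasureTheory.volume x y :=
    fun x y hx hy => ((hint x y hx hy).sub intervalIntegrable_const).abs
  have hleft : (∫ r in a..c, |1 / r - 1 / c|) = Real.log (c / a) - (c - a) / c := by
    rw [integral_congr (g := fun r => 1 / r - 1 / c),
      integral_sub (hint a c ha hc0) intervalIntegrable_const,
      integral_one_div_of_pos ha hc0, integral_const, smul_eq_mul, mul_one_div]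
    intro r hr
    rw [Set.uIcc_of_le hac] at hr
    exact abs_of_nonneg (sub_nonneg.2 (one_div_le_one_div_of_le (ha.trans_le hr.1) hr.2))
  have hright : (∫ r in c..b, |1 / r - 1 / c|) = (b - c) / c - Real.log (b / c) := by
    rw [integral_congr (g := fun r => 1 / c - 1 / r),
      integral_sub intervalIntegrable_const (hint c b hc0 hb0),
      integral_one_div_of_pos hc0 hb0, integral_const, smul_eq_mul, mul_one_div]
    intro r hr
    rw [Set.uIcc_of_le hcb] at hr
    dsimp only
    rw [abs_of_nonpos (sub_nonpos.2 (one_div_le_one_div_of_le hc0 hr.1)), neg_sub]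
  rw [← integral_add_adjacent_intervals (hdist a c ha hc0) (hdist c b hc0 hb0), hleft, hright,
    Real.log_div hc0.ne' ha.ne', Real.log_div hb0.ne' hc0.ne']
  field_simp
  ring

/-- For `0 < a < b`, the function `c ↦ ∫_a^b |1/r - 1/c| dr` on `[a, b]` attains its
minimum uniquely at the midpoint `c* = (a+b)/2`, with minimum value
`log((a+b)²/(4ab))`; hence for `r` uniform on `[a, b]` the minimum of
`E[|1/r - 1/c|]` over `c ∈ [a, b]` equals `(1/(b-a))·log((a+b)²/(4ab))`. -/
theorem optimal_range_representative (a b : ℝ) (ha : 0 < a) (hab : a < b) :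
    (∀ c ∈ Set.Icc a b,
        (∫ r in a..b, |1 / r - 1 / ((a + b) / 2)|) ≤ ∫ r in a..b, |1 / r - 1 / c|) ∧
    (∀ c ∈ Set.Icc a b,
        (∫ r in a..b, |1 / r - 1 / c|) = (∫ r in a..b, |1 / r - 1 / ((a + b) / 2)|) →
          c = (a + b) / 2) ∧
    (∫ r in a..b, |1 / r - 1 / ((a + b) / 2)|) = Real.log ((a + b) ^ 2 / (4 * a * b)) ∧
    IsLeast ((fun c => (1 / (b - a)) * ∫ r in a..b, |1 / r - 1 / c|) '' Set.Icc a b)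
      ((1 / (b - a)) * Real.log ((a + b) ^ 2 / (4 * a * b))) := by
  have hm : (a + b) / 2 ∈ Set.Icc a b := ⟨by linarith, by linarith⟩
  have hm0 : 0 < (a + b) / 2 := ha.trans_le hm.1
  have hb : 0 < b := ha.trans hab
  have hlt : ∀ c ∈ Set.Icc a b, c ≠ (a + b) / 2 →
      (∫ r in a..b, |1 / r - 1 / ((a + b) / 2)|) < ∫ r in a..b, |1 / r - 1 / c| := by
    intro c hc hne
    have hc0 : 0 < c := ha.trans_le hc.1
    rw [integral_abs_one_div_sub_one_div ha hm, integral_abs_one_div_sub_one_div ha hc]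
    have hlog := Real.log_lt_sub_one_of_pos (div_pos hm0 hc0)
      (fun h => hne ((div_eq_one_iff_eq hc0.ne').1 h).symm)
    rw [Real.log_div hm0.ne' hc0.ne'] at hlog
    have hmid : (a + b) / ((a + b) / 2) = 2 := by field_simp
    have hhalf : (a + b) / c = 2 * ((a + b) / 2 / c) := by ring
    linarith
  have hle : ∀ c ∈ Set.Icc a b,
      (∫ r in a..b, |1 / r - 1 / ((a + b) / 2)|) ≤ ∫ r in a..b, |1 / r - 1 / c| := by
    intro c hc
    rcases eq_or_ne c ((a + b) / 2) with rfl | hne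
    · exact le_rfl
    · exact (hlt c hc hne).le
  have hval : (∫ r in a..b, |1 / r - 1 / ((a + b) / 2)|) =
      Real.log ((a + b) ^ 2 / (4 * a * b)) := by
    have hsq : (a + b) ^ 2 / (4 * a * b) = ((a + b) / 2) ^ 2 / (a * b) := by
      field_simp
      ring
    have hmid : (a + b) / ((a + b) / 2) = 2 := by field_simp
    rw [integral_abs_one_div_sub_one_div ha hm, hsq,
      Real.log_div (pow_pos hm0 2).ne' (mul_pos ha hb).ne', Real.log_pow,
      Real.log_mul ha.ne' hb.ne', hmid]
    push_cast
    ring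
  refine ⟨hle, fun c hc h => ?_, hval, ⟨(a + b) / 2, hm, by simp only [hval]⟩, ?_⟩
  · by_contra hne
    exact (hlt c hc hne).ne' h
  · rintro _ ⟨c, hc, rfl⟩
    rw [← hval]
    exact mul_le_mul_of_nonneg_left (hle c hc) (one_div_pos.2 (sub_pos.2 hab)).le
end

section
/- Let 0 < a < b, let N ≥ 1 be an integer, set ρ = b/a and ξ = ρ^{1/N}, and define the geometric range samples r̂_i = (a/2)·(ξ^{−1} + 1)·ξ^i for i = 1, ..., N. Then ∫_a^b min_{1≤i≤N} |1/r − 1/r̂_i| dr ≤ 2N · log( (ρ^{1/(2N)} + ρ^{−1/(2N)}) / 2 ). Equivalently, for r uniformly distributed on [a, b], the expected range-sampling error E[min_i |1/r − 1/r̂_i|] is at most (2N/(b − a))·log((ρ^{1/(2N)} + ρ^{−1/(2N)})/2). -/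
open intervalIntegral Real

/-- The reciprocal deviation from the midpoint of `[c, d]`, integrated over `[c, d]`. -/
lemma integral_abs_one_div_sub_one_div_midpoint {c d : ℝ} (hc : 0 < c) (hcd : c ≤ d) :
    (∫ r in c..d, |1 / r - 1 / ((c + d) / 2)|) =
      2 * Real.log ((c + d) / 2) - Real.log c - Real.log d := by
  obtain ⟨m, hm⟩ : ∃ m, m = (c + d) / 2 := ⟨_, rfl⟩
  rw [← hm]
  have hcm : c ≤ m := by linarith
  have hmd : m ≤ d := by linarith
  have hm0 : 0 < m := by linarith
  have hd0 : 0 < d := by linarith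
  have hint : ∀ {x y : ℝ}, 0 < x → x ≤ y →
      IntervalIntegrable (fun r : ℝ => 1 / r) MeasureTheory.volume x y := fun hx hxy =>
    intervalIntegrable_one_div
      (fun r hr => by
        rw [Set.uIcc_of_le hxy] at hr
        exact (hx.trans_le hr.1).ne') continuousOn_id
  have hconst : ∀ x y : ℝ,
      IntervalIntegrable (fun _ : ℝ => 1 / m) MeasureTheory.volume x y :=
    fun _ _ => intervalIntegrable_const
  have hleft : (∫ r in c..m, |1 / r - 1 / m|) = ∫ r in c..m, (1 / r - 1 / m) := by
    refine integral_congr fun r hr => ?_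
    rw [Set.uIcc_of_le hcm] at hr
    exact abs_of_nonneg (sub_nonneg.2 (one_div_le_one_div_of_le (hc.trans_le hr.1) hr.2))
  have hright : (∫ r in m..d, |1 / r - 1 / m|) = ∫ r in m..d, (1 / m - 1 / r) := by
    refine integral_congr fun r hr => ?_
    rw [Set.uIcc_of_le hmd] at hr
    rw [abs_sub_comm]
    exact abs_of_nonneg (sub_nonneg.2 (one_div_le_one_div_of_le hm0 hr.1))
  rw [← integral_add_adjacent_intervals (b := m)
      ((hint hc hcm).sub (hconst c m)).abs ((hint hm0 hmd).sub (hconst m d)).abs,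
    hleft, hright, integral_sub (hint hc hcm) (hconst c m),
    integral_sub (hconst m d) (hint hm0 hmd), integral_one_div_of_pos hc hm0,
    integral_one_div_of_pos hm0 hd0, intervalIntegral.integral_const,
    intervalIntegral.integral_const, Real.log_div hm0.ne' hc.ne', Real.log_div hd0.ne' hm0.ne',
    show d - m = m - c by linarith]
  ring

/-- The midpoint integral over a cell of ratio `t ^ 2` does not depend on where the cell starts. -/
lemma integral_abs_one_div_sub_one_div_midpoint_mul_sq {c t : ℝ} (hc : 0 < c) (ht : 1 ≤ t) :
    (∫ r in c..c * t ^ 2, |1 / r - 1 / ((c + c * t ^ 2) / 2)|) =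
      2 * Real.log ((t + t⁻¹) / 2) := by
  have ht0 : 0 < t := by linarith
  rw [integral_abs_one_div_sub_one_div_midpoint hc
      (le_mul_of_one_le_right hc.le (one_le_pow₀ ht)),
    show (c + c * t ^ 2) / 2 = c * t * ((t + t⁻¹) / 2) by field_simp; ring,
    Real.log_mul (by positivity) (by positivity), Real.log_mul hc.ne' ht0.ne',
    Real.log_mul hc.ne' (by positivity), Real.log_pow]
  push_cast
  ring

lemma continuousOn_iInf_abs_one_div_sub {ι : Type*} [Fintype ι] [Nonempty ι] (v : ι → ℝ)
    {s : Set ℝ} (hs : ∀ r ∈ s, r ≠ 0) :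
    ContinuousOn (fun r : ℝ => ⨅ i, |1 / r - v i|) s := by
  simp_rw [← Finset.inf'_univ_eq_ciInf]
  exact ContinuousOn.finset_inf'_apply _ fun i _ =>
    ((continuousOn_const.div continuousOn_id hs).sub continuousOn_const).abs

/-- Total error of the codebook formed by the midpoints of `N` geometric cells of ratio `t ^ 2`. -/
lemma integral_iInf_abs_one_div_sub_geometric_le {a t : ℝ} (ha : 0 < a) (ht : 1 ≤ t)
    {N : ℕ} (hN : 1 ≤ N) :
    (∫ r in a..a * (t ^ 2) ^ N, ⨅ i : Fin N,
        |1 / r - 1 / ((a / 2) * ((t ^ 2)⁻¹ + 1) * (t ^ 2) ^ (i.val + 1))|) ≤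
      2 * (N : ℝ) * Real.log ((t + t⁻¹) / 2) := by
  have ht0 : 0 < t := by linarith
  have : Nonempty (Fin N) := ⟨⟨0, hN⟩⟩
  set f : ℝ → ℝ := fun r => ⨅ i : Fin N,
    |1 / r - 1 / ((a / 2) * ((t ^ 2)⁻¹ + 1) * (t ^ 2) ^ (i.val + 1))|
  have hpos : ∀ k : ℕ, 0 < a * (t ^ 2) ^ k := fun k => by positivity
  have hstep : ∀ k : ℕ, a * (t ^ 2) ^ (k + 1) = a * (t ^ 2) ^ k * t ^ 2 := fun k => by ring
  have hmono : ∀ k : ℕ, a * (t ^ 2) ^ k ≤ a * (t ^ 2) ^ (k + 1) := fun k => by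
    rw [hstep]
    exact le_mul_of_one_le_right (hpos k).le (one_le_pow₀ ht)
  have hne : ∀ k : ℕ, ∀ r ∈ Set.uIcc (a * (t ^ 2) ^ k) (a * (t ^ 2) ^ (k + 1)), r ≠ 0 :=
    fun k r hr => by
      rw [Set.uIcc_of_le (hmono k)] at hr
      exact ((hpos k).trans_le hr.1).ne'
  have hf : ∀ k : ℕ, IntervalIntegrable f MeasureTheory.volume
      (a * (t ^ 2) ^ k) (a * (t ^ 2) ^ (k + 1)) := fun k =>
    (continuousOn_iInf_abs_one_div_sub _ (hne k)).intervalIntegrable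
  have hsum := sum_integral_adjacent_intervals (f := f) (μ := MeasureTheory.volume)
    (a := fun k => a * (t ^ 2) ^ k) (n := N) fun k _ => hf k
  simp only [pow_zero, mul_one] at hsum
  rw [← hsum]
  have hcell : ∀ k ∈ Finset.range N,
      (∫ r in a * (t ^ 2) ^ k..a * (t ^ 2) ^ (k + 1), f r) ≤
        2 * Real.log ((t + t⁻¹) / 2) := fun k hk => by
    rw [← integral_abs_one_div_sub_one_div_midpoint_mul_sq (hpos k) ht, ← hstep]
    refine integral_mono_on (hmono k) (hf k) ?_ fun r _ => ?_
    · exact ((continuousOn_const.div continuousOn_id (hne k)).sub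
        continuousOn_const).abs.intervalIntegrable
    · refine (ciInf_le (Set.finite_range _).bddBelow ⟨k, Finset.mem_range.1 hk⟩).trans_eq ?_
      congr 3
      field_simp
      ring
  refine (Finset.sum_le_sum hcell).trans_eq ?_
  rw [Finset.sum_const, Finset.card_range, nsmul_eq_mul]
  ring

/-- For `0 < a < b`, `ρ = b/a`, `ξ = ρ^{1/N}`, and the geometric range samples
`r̂ i = (a/2)(ξ⁻¹ + 1)ξ^i`, `i = 1, ..., N`, the total range-sampling error satisfies
`∫_a^b min_i |1/r - 1/r̂ i| dr ≤ 2N·log((ρ^{1/(2N)} + ρ^{-1/(2N)})/2)`; equivalently,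
for `r` uniform on `[a, b]` the expected error is at most
`(2N/(b-a))·log((ρ^{1/(2N)} + ρ^{-1/(2N)})/2)`. -/
theorem geometric_codebook_error_bound (a b : ℝ) (ha : 0 < a) (hab : a < b)
    (N : ℕ) (hN : 1 ≤ N) :
    (∫ r in a..b, ⨅ i : Fin N,
        |1 / r - 1 / ((a / 2) * (((b / a) ^ ((1 : ℝ) / N))⁻¹ + 1) *
          ((b / a) ^ ((1 : ℝ) / N)) ^ (i.val + 1))|) ≤
      2 * (N : ℝ) * Real.log (((b / a) ^ ((1 : ℝ) / (2 * N)) +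
        (b / a) ^ (-(1 : ℝ) / (2 * N))) / 2) ∧
    (1 / (b - a)) * (∫ r in a..b, ⨅ i : Fin N,
        |1 / r - 1 / ((a / 2) * (((b / a) ^ ((1 : ℝ) / N))⁻¹ + 1) *
          ((b / a) ^ ((1 : ℝ) / N)) ^ (i.val + 1))|) ≤
      (2 * (N : ℝ) / (b - a)) * Real.log (((b / a) ^ ((1 : ℝ) / (2 * N)) +
        (b / a) ^ (-(1 : ℝ) / (2 * N))) / 2) := by
  have hρ : 0 < b / a := div_pos (ha.trans hab) ha
  have hN0 : (N : ℝ) ≠ 0 := by positivity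
  have ht : 1 ≤ (b / a) ^ ((1 : ℝ) / (2 * N)) :=
    Real.one_le_rpow ((one_le_div ha).2 hab.le) (by positivity)
  have hξ : (b / a) ^ ((1 : ℝ) / N) = ((b / a) ^ ((1 : ℝ) / (2 * N))) ^ 2 := by
    rw [← Real.rpow_mul_natCast hρ.le]
    congr 1
    push_cast
    field_simp
  have hinv : (b / a) ^ (-(1 : ℝ) / (2 * N)) = ((b / a) ^ ((1 : ℝ) / (2 * N)))⁻¹ := by
    rw [neg_div, Real.rpow_neg hρ.le]
  have hb : b = a * (((b / a) ^ ((1 : ℝ) / (2 * N))) ^ 2) ^ N := by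
    rw [← hξ, one_div, Real.rpow_inv_natCast_pow hρ.le (by omega), mul_div_cancel₀ _ ha.ne']
  have key := integral_iInf_abs_one_div_sub_geometric_le ha ht hN
  rw [← hb, ← hξ, ← hinv] at key
  refine ⟨key, ?_⟩
  have hlen : 0 ≤ 1 / (b - a) := one_div_nonneg.2 (sub_pos.2 hab).le
  exact (mul_le_mul_of_nonneg_left key hlen).trans_eq (by ring)
end
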